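/- Let T be a 3-form on an n-dimensional Euclidean vector space, acting on spinors via Clifford multiplication, and let σ_T := (1/2) Σ_k (e_k ⌟ T) ∧ (e_k ⌟ T) for an orthonormal basis e_1,...,e_n. Then inside the Clifford algebra, T² = -2σ_T + ||T||². -/

import Mathlib

/-!
STATEMENT 0: Let `T` be a 3-form on an `n`-dimensional Euclidean vector space
(identified with a multivector, and acting on spinors via the standard embedding
of exterior forms into the Clifford algebra `Cl(V)` with relations
`e_i·e_j + e_j·e_i = -2δ_{ij}`), and let
`σ_T := (1/2) ∑_k (e_k ⌟ T) ∧ (e_k ⌟ T)` for the orthonormal basis `e_1, …, e_n`.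
Then inside the Clifford algebra, `T² = -2·σ_T + ‖T‖²`.

We model `V = ℝⁿ` with orthonormal basis `e_i = Pi.single i 1`; the Clifford
algebra of the (negative definite) quadratic form `Q(v) = -∑ vᵢ²`; 3-forms as
elements `∑_{i<j<k} c i j k • eᵢ ∧ eⱼ ∧ e_k` of the exterior algebra; the
interiorProd product `e_k ⌟ ·` as contraction with the metric-dual covector (the
`k`-th coordinate functional); and the standard embedding of forms into the
Clifford algebra as the inverse of `CliffordAlgebra.equivExterior`.
-/

noncomputable section

/-- The quadratic form `Q(v) = -∑ vᵢ²`, so that `ι(eᵢ)·ι(eⱼ) + ι(eⱼ)·ι(eᵢ) = -2δᵢⱼ`. -/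
def Q (n : ℕ) : QuadraticForm ℝ (Fin n → ℝ) :=
  QuadraticMap.weightedSumSquares ℝ (fun _ : Fin n => (-1 : ℝ))

/-- The standard embedding of exterior forms into the Clifford algebra. -/
def quantize (n : ℕ) : ExteriorAlgebra ℝ (Fin n → ℝ) ≃ₗ[ℝ] CliffordAlgebra (Q n) :=
  letI : Invertible (2 : ℝ) := invertibleOfNonzero two_ne_zero
  (CliffordAlgebra.equivExterior (Q n)).symm

/-- The orthonormal basis vector `e_i`, as an element of the exterior algebra. -/
def e (n : ℕ) (i : Fin n) : ExteriorAlgebra ℝ (Fin n → ℝ) :=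
  ExteriorAlgebra.ι ℝ (Pi.single i 1)

/-- The 3-form `T = ∑_{i<j<k} c i j k • eᵢ ∧ eⱼ ∧ e_k` with coefficients `c`. -/
def formT (n : ℕ) (c : Fin n → Fin n → Fin n → ℝ) : ExteriorAlgebra ℝ (Fin n → ℝ) :=
  ∑ i, ∑ j, ∑ k, if i < j ∧ j < k then c i j k • (e n i * e n j * e n k) else 0

/-- The interiorProd product `e_k ⌟ ω` (contraction with the metric dual of `e_k`,
i.e. the `k`-th coordinate functional). -/
def interiorProd (n : ℕ) (k : Fin n) (ω : ExteriorAlgebra ℝ (Fin n → ℝ)) :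
    ExteriorAlgebra ℝ (Fin n → ℝ) :=
  CliffordAlgebra.contractLeft (Q := (0 : QuadraticForm ℝ (Fin n → ℝ)))
    (LinearMap.proj k) ω

/-- The 4-form `σ_T := (1/2) ∑_k (e_k ⌟ T) ∧ (e_k ⌟ T)`. -/
def sigmaT (n : ℕ) (c : Fin n → Fin n → Fin n → ℝ) : ExteriorAlgebra ℝ (Fin n → ℝ) :=
  (1/2 : ℝ) • ∑ k, interiorProd n k (formT n c) * interiorProd n k (formT n c)

/-- The squared norm `‖T‖² = ∑_{i<j<k} (c i j k)²`. -/
def normSqT (n : ℕ) (c : Fin n → Fin n → Fin n → ℝ) : ℝ :=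
  ∑ i, ∑ j, ∑ k, if i < j ∧ j < k then (c i j k)^2 else 0

def cg (n : ℕ) (i : Fin n) : CliffordAlgebra (Q n) := CliffordAlgebra.ι (Q n) (Pi.single i 1)

lemma cg_sq (n : ℕ) (i : Fin n) : cg n i * cg n i = -1 := by
  rw [cg, CliffordAlgebra.ι_sq_scalar]
  have : Q n (Pi.single i 1) = -1 := by
    simp [Q, QuadraticMap.weightedSumSquares_apply, Pi.single_apply]
  rw [this, map_neg, map_one]

lemma polar_ne (n : ℕ) {i j : Fin n} (h : i ≠ j) :
    QuadraticMap.polar (Q n) (Pi.single i 1) (Pi.single j 1) = 0 := by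
  simp [QuadraticMap.polar, Q, QuadraticMap.weightedSumSquares_apply, Pi.single_apply, add_mul,
    mul_add, Finset.sum_add_distrib, h, h.symm]

lemma cg_anti (n : ℕ) (i j : Fin n) (h : j < i) : cg n i * cg n j = -(cg n j * cg n i) := by
  have := CliffordAlgebra.ι_mul_ι_add_swap (Q := Q n) (Pi.single i 1) (Pi.single j 1)
  rw [polar_ne n h.ne', map_zero] at this
  exact eq_neg_of_add_eq_zero_left this

lemma cg_anti' (n : ℕ) (i j : Fin n) (x) (h : j < i) :
    cg n i * (cg n j * x) = -(cg n j * (cg n i * x)) := by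
  rw [← mul_assoc, cg_anti n i j h, neg_mul, mul_assoc]

lemma cg_sq' (n : ℕ) (i : Fin n) (x) : cg n i * (cg n i * x) = -x := by
  rw [← mul_assoc, cg_sq, neg_one_mul]

lemma e_sq (n : ℕ) (i : Fin n) : e n i * e n i = 0 := by
  simp [e]

lemma e_sq' (n : ℕ) (i : Fin n) (x) : e n i * (e n i * x) = 0 := by
  rw [← mul_assoc, e_sq, zero_mul]

lemma e_anti (n : ℕ) (i j : Fin n) (_h : j < i) : e n i * e n j = -(e n j * e n i) :=
  eq_neg_of_add_eq_zero_left (ExteriorAlgebra.ι_add_mul_swap _ _)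

lemma e_anti' (n : ℕ) (i j : Fin n) (x) (h : j < i) :
    e n i * (e n j * x) = -(e n j * (e n i * x)) := by
  rw [← mul_assoc, e_anti n i j h, neg_mul, mul_assoc]

lemma proj_single_ne (n : ℕ) {i j : Fin n} (h : i ≠ j) :
    interiorProd n i (e n j) = 0 := by
  simp [interiorProd, e, ExteriorAlgebra.ι, Pi.single_apply, h]

def dl (n : ℕ) (i j : Fin n) : ℝ := if i = j then 1 else 0

lemma dl_self (n : ℕ) (i : Fin n) : dl n i i = 1 := by simp [dl]
lemma dl_lt (n : ℕ) (i j : Fin n) (h : i < j) : dl n i j = 0 := by simp [dl, h.ne]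
lemma dl_gt (n : ℕ) (i j : Fin n) (h : j < i) : dl n i j = 0 := by simp [dl, h.ne']

lemma contr_e_mul (n : ℕ) (p i : Fin n) (x) :
    interiorProd n p (e n i * x) = dl n p i • x - e n i * interiorProd n p x := by
  have := CliffordAlgebra.contractLeft_ι_mul (Q := (0 : QuadraticForm ℝ (Fin n → ℝ)))
    (d := LinearMap.proj p) (Pi.single i 1) x
  refine this.trans ?_
  simp [dl, Pi.single_apply, interiorProd, e, ExteriorAlgebra.ι]

lemma contr_e (n : ℕ) (p i : Fin n) :
    interiorProd n p (e n i) = algebraMap ℝ _ (dl n p i) := by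
  simp [dl, Pi.single_apply, interiorProd, e, ExteriorAlgebra.ι]

lemma contr3 (n : ℕ) (p i j k : Fin n) :
    interiorProd n p (e n i * e n j * e n k) =
      dl n p i • (e n j * e n k) - dl n p j • (e n i * e n k) + dl n p k • (e n i * e n j) := by
  rw [mul_assoc, contr_e_mul, contr_e_mul, contr_e, Algebra.algebraMap_eq_smul_one]
  simp only [mul_sub, mul_smul_comm, mul_one]
  abel

lemma quant_one (n : ℕ) : quantize n 1 = 1 := by
  simp [quantize, CliffordAlgebra.equivExterior]

lemma bil_eq (n : ℕ) [Invertible (2 : ℝ)] (i : Fin n) :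
    (-(QuadraticMap.associated (R := ℝ) (-Q n))) (Pi.single i 1) =
      (-1 : ℝ) • (LinearMap.proj i : (Fin n → ℝ) →ₗ[ℝ] ℝ) := by
  refine LinearMap.pi_ext' fun j => LinearMap.ext_ring ?_
  by_cases h : i = j
  · subst h
    have h1 : Q n (Pi.single i 1) = -1 := by
      simp [Q, QuadraticMap.weightedSumSquares_apply, Pi.single_apply]
    have := QuadraticMap.associated_eq_self_apply ℝ (-Q n) (Pi.single i 1)
    simp only [LinearMap.comp_apply, LinearMap.neg_apply, LinearMap.smul_apply,
      LinearMap.single_apply, this]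
    simp [h1]
  · have h1 := polar_ne n h
    have := QuadraticMap.two_nsmul_associated ℝ (-Q n)
    have h2 := congrArg (fun B => B (Pi.single i 1) (Pi.single j 1)) this
    simp only [LinearMap.smul_apply, QuadraticMap.polarBilin_apply_apply, FunLike.coe_neg,
      QuadraticMap.polar_neg, h1, neg_zero] at h2
    have h3 : (QuadraticMap.associated (R := ℝ) (-Q n)) (Pi.single i 1) (Pi.single j 1) = 0 := by
      simpa using h2
    simp only [LinearMap.comp_apply, LinearMap.neg_apply, LinearMap.smul_apply,
      LinearMap.single_apply, h3]
    simp [h]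

lemma quant_e_mul (n : ℕ) (i : Fin n) (x) (h : interiorProd n i x = 0) :
    quantize n (e n i * x) = cg n i * quantize n x := by
  letI : Invertible (2 : ℝ) := invertibleOfNonzero two_ne_zero
  have hq : ∀ y, quantize n y = CliffordAlgebra.changeForm
    (CliffordAlgebra.changeForm.neg_proof
      (CliffordAlgebra.changeForm.associated_neg_proof (Q := Q n))) y := fun y => rfl
  rw [hq, hq]
  refine (CliffordAlgebra.changeForm_ι_mul _ _ _).trans ?_
  rw [← CliffordAlgebra.changeForm_contractLeft, bil_eq]
  rw [map_smul, LinearMap.smul_apply]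
  have h' : CliffordAlgebra.contractLeft (Q := (0 : QuadraticForm ℝ (Fin n → ℝ)))
    (LinearMap.proj i) x = 0 := h
  rw [h', smul_zero, map_zero, sub_zero]
  rfl

lemma quant1 (n : ℕ) (i : Fin n) : quantize n (e n i) = cg n i := by
  have := quant_e_mul n i 1 (CliffordAlgebra.contractLeft_one _ _)
  rwa [mul_one, quant_one, mul_one] at this

lemma quant2 (n : ℕ) (i j : Fin n) (h : i < j) :
    quantize n (e n i * e n j) = cg n i * cg n j := by
  rw [quant_e_mul, quant1]
  simp [contr_e, dl_lt, h]

lemma quant3 (n : ℕ) (i j k : Fin n) (h : i < j) (h' : j < k) :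
    quantize n (e n i * (e n j * e n k)) = cg n i * (cg n j * cg n k) := by
  rw [quant_e_mul, quant2 n j k h']
  simp [contr_e_mul, contr_e, dl_lt, h, h.trans h']

lemma quant4 (n : ℕ) (i j k l : Fin n) (h : i < j) (h' : j < k) (h'' : k < l) :
    quantize n (e n i * (e n j * (e n k * e n l))) = cg n i * (cg n j * (cg n k * cg n l)) := by
  rw [quant_e_mul, quant3 n j k l h' h'']
  simp [contr_e_mul, contr_e, dl_lt, h, h.trans h', (h.trans h').trans h'']

def W (n : ℕ) (i j k l m r : Fin n) : ExteriorAlgebra ℝ (Fin n → ℝ) :=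
  dl n i l • (e n j * e n k * (e n m * e n r)) - dl n i m • (e n j * e n k * (e n l * e n r))
  + dl n i r • (e n j * e n k * (e n l * e n m))
  - dl n j l • (e n i * e n k * (e n m * e n r)) + dl n j m • (e n i * e n k * (e n l * e n r))
  - dl n j r • (e n i * e n k * (e n l * e n m))
  + dl n k l • (e n i * e n j * (e n m * e n r)) - dl n k m • (e n i * e n j * (e n l * e n r))
  + dl n k r • (e n i * e n j * (e n l * e n m))

lemma sum_dl (n : ℕ) (i j : Fin n) (x : ExteriorAlgebra ℝ (Fin n → ℝ)) :
    ∑ p, dl n p j • dl n p i • x = dl n i j • x := by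
  simp [dl]

lemma sum_contr (n : ℕ) (i j k l m r : Fin n) :
    ∑ p, interiorProd n p (e n i * e n j * e n k) * interiorProd n p (e n l * e n m * e n r)
      = W n i j k l m r := by
  simp only [contr3, sub_mul, add_mul, mul_sub, mul_add, smul_mul_assoc, mul_smul_comm,
    Finset.sum_add_distrib, Finset.sum_sub_distrib, smul_add, smul_sub, sum_dl, W]
  abel

set_option maxHeartbeats 4000000 in
lemma key (n : ℕ) (i j k l m r : Fin n) (hij : i < j) (hjk : j < k) (hlm : l < m) (hmr : m < r) :
    cg n i * (cg n j * cg n k) * (cg n l * (cg n m * cg n r)) +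
      cg n l * (cg n m * cg n r) * (cg n i * (cg n j * cg n k)) =
    (-2 : ℝ) • quantize n (W n i j k l m r) +
      (2 * (dl n i l * dl n j m * dl n k r)) • (1 : CliffordAlgebra (Q n)) := by
  have hik := hij.trans hjk
  have hlr := hlm.trans hmr
  unfold W
  rcases lt_trichotomy i l with h1 | h1 | h1 <;>
  rcases lt_trichotomy i m with h2 | h2 | h2 <;> (try (exfalso; order)) <;>
  rcases lt_trichotomy i r with h3 | h3 | h3 <;> (try (exfalso; order)) <;>
  rcases lt_trichotomy j l with h4 | h4 | h4 <;> (try (exfalso; order)) <;>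
  rcases lt_trichotomy j m with h5 | h5 | h5 <;> (try (exfalso; order)) <;>
  rcases lt_trichotomy j r with h6 | h6 | h6 <;> (try (exfalso; order)) <;>
  rcases lt_trichotomy k l with h7 | h7 | h7 <;> (try (exfalso; order)) <;>
  rcases lt_trichotomy k m with h8 | h8 | h8 <;> (try (exfalso; order)) <;>
  rcases lt_trichotomy k r with h9 | h9 | h9 <;> (try (exfalso; order)) <;>
  subst_vars <;>
  simp only [mul_assoc, cg_anti, cg_anti', cg_sq, cg_sq', e_anti, e_anti', e_sq, e_sq', quant4,
    dl_self, dl_lt, dl_gt, map_add, map_sub, map_smul, map_neg, map_zero, mul_neg, neg_mul,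
    neg_neg, mul_zero, zero_mul, smul_zero, zero_smul, one_smul, mul_one, one_mul, neg_zero, *] <;>
  module

lemma formT_eq (n : ℕ) (c : Fin n → Fin n → Fin n → ℝ) :
    formT n c = ∑ x : Fin n × Fin n × Fin n with x.1 < x.2.1 ∧ x.2.1 < x.2.2,
      c x.1 x.2.1 x.2.2 • (e n x.1 * e n x.2.1 * e n x.2.2) := by
  rw [Finset.sum_filter, Fintype.sum_prod_type]
  simp only [Fintype.sum_prod_type, formT]

lemma normSqT_eq (n : ℕ) (c : Fin n → Fin n → Fin n → ℝ) :
    normSqT n c = ∑ x : Fin n × Fin n × Fin n with x.1 < x.2.1 ∧ x.2.1 < x.2.2,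
      c x.1 x.2.1 x.2.2 ^ 2 := by
  rw [Finset.sum_filter, Fintype.sum_prod_type]
  simp only [Fintype.sum_prod_type, normSqT]

lemma interior_sum (n : ℕ) (p : Fin n) {α : Type} (s : Finset α) (a : α → ℝ)
    (f : α → ExteriorAlgebra ℝ (Fin n → ℝ)) :
    interiorProd n p (∑ x ∈ s, a x • f x) = ∑ x ∈ s, a x • interiorProd n p (f x) := by
  unfold interiorProd
  erw [map_sum]
  exact Finset.sum_congr rfl fun x _ => map_smul _ _ _

lemma dl_prod (n : ℕ) (x y : Fin n × Fin n × Fin n) :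
    dl n x.1 y.1 * dl n x.2.1 y.2.1 * dl n x.2.2 y.2.2 = (if x = y then 1 else 0 : ℝ) := by
  obtain ⟨i, j, k⟩ := x
  obtain ⟨l, m, r⟩ := y
  by_cases h1 : i = l <;> by_cases h2 : j = m <;> by_cases h3 : k = r <;> simp [dl, h1, h2, h3]

set_option maxHeartbeats 1000000 in
/-- In the Clifford algebra, `T² = -2·σ_T + ‖T‖²`. -/
theorem clifford_square_of_three_form (n : ℕ) (c : Fin n → Fin n → Fin n → ℝ) :
    quantize n (formT n c) * quantize n (formT n c) =
      (-2 : ℝ) • quantize n (sigmaT n c) +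
        algebraMap ℝ (CliffordAlgebra (Q n)) (normSqT n c) := by
  set s : Finset (Fin n × Fin n × Fin n) :=
    Finset.univ.filter (fun x => x.1 < x.2.1 ∧ x.2.1 < x.2.2) with hs
  let a : Fin n × Fin n × Fin n → ℝ := fun x => c x.1 x.2.1 x.2.2
  let E : Fin n × Fin n × Fin n → ExteriorAlgebra ℝ (Fin n → ℝ) :=
    fun x => e n x.1 * e n x.2.1 * e n x.2.2
  let G : Fin n × Fin n × Fin n → CliffordAlgebra (Q n) :=
    fun x => cg n x.1 * (cg n x.2.1 * cg n x.2.2)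
  let w : Fin n × Fin n × Fin n → Fin n × Fin n × Fin n → ExteriorAlgebra ℝ (Fin n → ℝ) :=
    fun x y => W n x.1 x.2.1 x.2.2 y.1 y.2.1 y.2.2
  have hF : formT n c = ∑ x ∈ s, a x • E x := formT_eq n c
  have hN : normSqT n c = ∑ x ∈ s, a x ^ 2 := normSqT_eq n c
  have hmem : ∀ x ∈ s, x.1 < x.2.1 ∧ x.2.1 < x.2.2 := fun x hx => (Finset.mem_filter.1 hx).2
  have hT : quantize n (formT n c) = ∑ x ∈ s, a x • G x := by
    rw [hF, map_sum]
    refine Finset.sum_congr rfl fun x hx => ?_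
    rw [map_smul]
    simp only [E, G, mul_assoc]
    rw [quant3 n _ _ _ (hmem x hx).1 (hmem x hx).2]
  have hTT : quantize n (formT n c) * quantize n (formT n c) =
      ∑ x ∈ s, ∑ y ∈ s, (a x * a y) • (G x * G y) := by
    rw [hT, Finset.sum_mul_sum]
    simp only [smul_mul_smul_comm]
  have hTT' : quantize n (formT n c) * quantize n (formT n c) =
      ∑ x ∈ s, ∑ y ∈ s, (a x * a y) • (G y * G x) := by
    rw [hTT, Finset.sum_comm]
    refine Finset.sum_congr rfl fun x _ => Finset.sum_congr rfl fun y _ => ?_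
    rw [mul_comm (a y)]
  have hS : sigmaT n c = (1/2 : ℝ) • ∑ x ∈ s, ∑ y ∈ s, (a x * a y) • w x y := by
    unfold sigmaT
    rw [hF]
    simp only [interior_sum, Finset.sum_mul_sum, smul_mul_smul_comm]
    rw [Finset.sum_comm]
    congr 1
    refine Finset.sum_congr rfl fun x _ => ?_
    rw [Finset.sum_comm]
    refine Finset.sum_congr rfl fun y _ => ?_
    rw [← Finset.smul_sum, sum_contr]
  have hk : ∀ x ∈ s, ∀ y ∈ s, G x * G y + G y * G x =
      (-2 : ℝ) • quantize n (w x y) +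
        (2 * (if x = y then 1 else 0 : ℝ)) • (1 : CliffordAlgebra (Q n)) := by
    intro x hx y hy
    have := key n x.1 x.2.1 x.2.2 y.1 y.2.1 y.2.2 (hmem x hx).1 (hmem x hx).2
      (hmem y hy).1 (hmem y hy).2
    refine this.trans ?_
    rw [dl_prod]
  have h2 : (2 : ℝ) • (quantize n (formT n c) * quantize n (formT n c)) =
      (2 : ℝ) • ((-2 : ℝ) • quantize n (sigmaT n c) +
        algebraMap ℝ (CliffordAlgebra (Q n)) (normSqT n c)) := by
    rw [two_smul]
    nth_rewrite 1 [hTT]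
    rw [hTT', ← Finset.sum_add_distrib]
    simp only [← Finset.sum_add_distrib, ← smul_add]
    rw [Finset.sum_congr rfl fun x hx => Finset.sum_congr rfl fun y hy => by rw [hk x hx y hy]]
    simp only [smul_add, Finset.sum_add_distrib]
    congr 1
    · rw [hS]
      simp only [map_smul, map_sum, Finset.smul_sum, smul_smul]
      refine Finset.sum_congr rfl fun x _ => Finset.sum_congr rfl fun y _ => ?_
      congr 1
      ring
    · rw [hN, Algebra.algebraMap_eq_smul_one, Finset.sum_smul, Finset.smul_sum]
      refine Finset.sum_congr rfl fun x hx => ?_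
      rw [Finset.sum_eq_single x]
      · simp only [if_true, smul_smul]
        congr 1
        ring
      · intro y _ hy
        simp [hy.symm]
      · intro h
        exact absurd hx h
  exact smul_right_injective _ (two_ne_zero (α := ℝ)) h2
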